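/- Let X be an integrable real random variable whose cumulative distribution function F is continuous, and let 0 < α < β < 1. Then P(q(α) ≤ X ≤ q(β)) = β − α and the Range Value-at-Risk satisfies RVaR_{α,β}(X) := (1/(β−α))·∫_α^β VaR_u(X) du = E[−X | q(α) ≤ X ≤ q(β)] = E[−X | −VaR_α(X) ≤ X ≤ −VaR_β(X)]. -/

import Mathlib

open MeasureTheory
open ProbabilityTheory Set Filter Topology

/-- The Galois connection between a continuous distribution function and its lower quantile. -/
theorem sInf_le_iff_le_cdf (ν : Measure ℝ) (hν : Continuous (cdf ν)) {u : ℝ}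
    (hu : u ∈ Ioo (0 : ℝ) 1) (x : ℝ) : sInf {y : ℝ | u ≤ cdf ν y} ≤ x ↔ u ≤ cdf ν x := by
  have hbdd : BddBelow {y : ℝ | u ≤ cdf ν y} := by
    obtain ⟨m, hm⟩ := ((tendsto_cdf_atBot ν).eventually_lt_const hu.1).exists
    exact ⟨m, fun y hy => le_of_not_gt fun h => (hy.trans (monotone_cdf ν h.le)).not_gt hm⟩
  have hne : {y : ℝ | u ≤ cdf ν y}.Nonempty :=
    ((tendsto_cdf_atTop ν).eventually_const_le hu.2).exists
  have hcl : IsClosed {y : ℝ | u ≤ cdf ν y} := isClosed_le continuous_const hν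
  exact ⟨fun h => (hcl.csInf_mem hne hbdd : u ≤ cdf ν _).trans (monotone_cdf ν h),
    fun h => csInf_le hbdd h⟩

/-- A continuous distribution function is a left inverse of its lower quantile. -/
theorem cdf_sInf_le_cdf (ν : Measure ℝ) (hν : Continuous (cdf ν)) {u : ℝ}
    (hu : u ∈ Ioo (0 : ℝ) 1) : cdf ν (sInf {y : ℝ | u ≤ cdf ν y}) = u := by
  obtain ⟨y, hy⟩ := mem_range_of_exists_le_of_exists_ge hν
    ((tendsto_cdf_atBot ν).eventually_le_const hu.1).exists
    ((tendsto_cdf_atTop ν).eventually_const_le hu.2).exists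
  refine le_antisymm ?_ ((sInf_le_iff_le_cdf ν hν hu _).1 le_rfl)
  exact (monotone_cdf ν ((sInf_le_iff_le_cdf ν hν hu y).2 hy.ge)).trans hy.le

theorem aemeasurable_restrict_of_le_iff_le_cdf (ν : Measure ℝ) {q : ℝ → ℝ}
    (hq : ∀ u ∈ Ioo (0 : ℝ) 1, ∀ x, q u ≤ x ↔ u ≤ cdf ν x) :
    AEMeasurable q (volume.restrict (Ioo 0 1)) :=
  aemeasurable_restrict_of_monotoneOn measurableSet_Ioo fun u hu v hv huv =>
    (hq u hu _).2 (huv.trans ((hq v hv _).1 le_rfl))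

/-- Inverse transform sampling: the quantile function pushes the uniform law on `(0, 1)` to `ν`. -/
theorem map_restrict_Ioo_eq_of_le_iff_le_cdf (ν : Measure ℝ) [IsProbabilityMeasure ν] {q : ℝ → ℝ}
    (hq : ∀ u ∈ Ioo (0 : ℝ) 1, ∀ x, q u ≤ x ↔ u ≤ cdf ν x) :
    (volume.restrict (Ioo 0 1)).map q = ν := by
  refine Measure.ext_of_Iic _ _ fun x => ?_
  rw [Measure.map_apply_of_aemeasurable (aemeasurable_restrict_of_le_iff_le_cdf ν hq)
    measurableSet_Iic, ← ofReal_cdf]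
  have hpre : q ⁻¹' Iic x =ᵐ[volume.restrict (Ioo 0 1)] Iic (cdf ν x) :=
    ae_restrict_of_forall_mem measurableSet_Ioo fun u hu => propext (hq u hu x)
  rw [measure_congr hpre, Measure.restrict_congr_set Ioo_ae_eq_Ioc, Measure.restrict_apply measurableSet_Iic, inter_comm,
    Ioc_inter_Iic, min_eq_right (cdf_le_one ν x), Real.volume_Ioc, sub_zero]

theorem nullSingletonClass_of_continuous_cdf (ν : Measure ℝ) [IsProbabilityMeasure ν]
    (hν : Continuous (cdf ν)) : NullSingletonClass ν := by
  refine ⟨fun x => ?_⟩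
  rw [← measure_cdf ν, StieltjesFunction.measure_singleton,
    hν.continuousAt.continuousWithinAt.leftLim_eq, sub_self, ENNReal.ofReal_zero]

/-- Let `X` be an integrable real random variable whose cumulative
distribution function `F` is continuous, and let `0 < α < β < 1`. Then
`P(q(α) ≤ X ≤ q(β)) = β − α` and the Range Value-at-Risk satisfies
`RVaR_{α,β}(X) = (1/(β−α))·∫_α^β VaR_u(X) du = E[−X | q(α) ≤ X ≤ q(β)]
= E[−X | −VaR_α(X) ≤ X ≤ −VaR_β(X)]`, where `q(u) = inf {x : u ≤ F x}`,
`VaR_u(X) = −q(u)` and `E[Z | A] = E[Z·1_A]/P(A)`. -/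
theorem rvar_as_conditional_expectation
    {Ω : Type*} [MeasurableSpace Ω] (P : Measure Ω) [IsProbabilityMeasure P]
    (X : Ω → ℝ) (hX : Measurable X) (hXi : Integrable X P)
    (F : ℝ → ℝ) (hF : ∀ x : ℝ, F x = (P {ω | X ω ≤ x}).toReal)
    (hFcont : Continuous F)
    (a b : ℝ) (hab : 0 < a ∧ a < b ∧ b < 1)
    (q : ℝ → ℝ) (hq : ∀ u : ℝ, q u = sInf {x : ℝ | u ≤ F x}) :
    (P {ω | q a ≤ X ω ∧ X ω ≤ q b}).toReal = b - a ∧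
      (1 / (b - a)) * (∫ u in a..b, -q u)
        = (∫ ω in {ω | q a ≤ X ω ∧ X ω ≤ q b}, (-X ω) ∂P) /
            (P {ω | q a ≤ X ω ∧ X ω ≤ q b}).toReal ∧
      (1 / (b - a)) * (∫ u in a..b, -q u)
        = (∫ ω in {ω | -(-q a) ≤ X ω ∧ X ω ≤ -(-q b)}, (-X ω) ∂P) /
            (P {ω | -(-q a) ≤ X ω ∧ X ω ≤ -(-q b)}).toReal := by
  obtain ⟨ha, hab, hb⟩ := hab
  have ha' : a ∈ Ioo (0 : ℝ) 1 := ⟨ha, hab.trans hb⟩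
  have hb' : b ∈ Ioo (0 : ℝ) 1 := ⟨ha.trans hab, hb⟩
  set ν := P.map X with hν
  have : IsProbabilityMeasure ν := Measure.isProbabilityMeasure_map hX.aemeasurable
  obtain rfl : F = cdf ν := by
    ext x
    rw [hF, cdf_eq_real, measureReal_def, hν, Measure.map_apply hX measurableSet_Iic]
    rfl
  have := nullSingletonClass_of_continuous_cdf ν hFcont
  have hgal : ∀ u ∈ Ioo (0 : ℝ) 1, ∀ x, q u ≤ x ↔ u ≤ cdf ν x := fun u hu x => by
    rw [hq, sInf_le_iff_le_cdf ν hFcont hu]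
  have hinv : ∀ u ∈ Ioo (0 : ℝ) 1, cdf ν (q u) = u := fun u hu => by
    rw [hq, cdf_sInf_le_cdf ν hFcont hu]
  have hset : {ω | q a ≤ X ω ∧ X ω ≤ q b} = X ⁻¹' Icc (q a) (q b) := rfl
  have hprob : (P {ω | q a ≤ X ω ∧ X ω ≤ q b}).toReal = b - a := by
    rw [hset, ← Measure.map_apply hX measurableSet_Icc, ← hν,
      ← measure_congr (Ioc_ae_eq_Icc (μ := ν)), ← measure_cdf ν, StieltjesFunction.measure_Ioc,
      hinv a ha', hinv b hb', ENNReal.toReal_ofReal (sub_nonneg.2 hab.le)]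
  have hint : ∫ ω in {ω | q a ≤ X ω ∧ X ω ≤ q b}, (-X ω) ∂P = ∫ u in a..b, -q u := by
    have hpre : q ⁻¹' Ioc (q a) (q b) =ᵐ[volume.restrict (Ioo 0 1)] Ioc a b :=
      ae_restrict_of_forall_mem measurableSet_Ioo fun u hu => propext <| by
        change q a < q u ∧ q u ≤ q b ↔ a < u ∧ u ≤ b
        rw [← not_le, hgal u hu, hgal u hu, hinv a ha', hinv b hb', not_le]
    have hsub : Ioc a b ∩ Ioo 0 1 = Ioc a b :=
      inter_eq_left.2 fun u hu => ⟨ha.trans hu.1, hu.2.trans_lt hb⟩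
    calc ∫ ω in {ω | q a ≤ X ω ∧ X ω ≤ q b}, (-X ω) ∂P
        = ∫ x in Ioc (q a) (q b), -x ∂ν := by
          rw [hset, ← integral_Icc_eq_integral_Ioc, hν]
          exact (setIntegral_map measurableSet_Icc (by fun_prop) hX.aemeasurable).symm
      _ = ∫ u in q ⁻¹' Ioc (q a) (q b), -q u ∂(volume.restrict (Ioo 0 1)) := by
          conv_lhs => rw [← map_restrict_Ioo_eq_of_le_iff_le_cdf ν hgal]
          exact setIntegral_map measurableSet_Ioc (by fun_prop)
            (aemeasurable_restrict_of_le_iff_le_cdf ν hgal)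
      _ = ∫ u in a..b, -q u := by
          rw [Measure.restrict_congr_set hpre, Measure.restrict_restrict measurableSet_Ioc, hsub,
            intervalIntegral.integral_of_le hab.le]
  simp only [neg_neg, hprob, hint]
  exact ⟨trivial, by ring, by ring⟩
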